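/- For p ∈ (0, ∞), the integral Menger curvature of E_{π/2} is finite if and only if p ∈ (0, 3); that is, M_p(E_{π/2}) < ∞ ⟺ 0 < p < 3. -/

import Mathlib

open MeasureTheory Real
open scoped ENNReal NNReal Classical

/-- The Menger curvature of three points in `ℝⁿ`: the reciprocal of the circumradius,
`κ(x,y,z) = 2 dist(z, L_{x,y}) / (|x-z| |y-z|)` for pairwise distinct non-collinear points,
and `0` otherwise. -/
noncomputable def menger {n : ℕ} (x y z : EuclideanSpace ℝ (Fin n)) : ℝ :=
  if x ≠ y ∧ y ≠ z ∧ x ≠ z ∧ ¬ Collinear ℝ ({x, y, z} : Set (EuclideanSpace ℝ (Fin n)))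
  then 2 * Metric.infDist z (affineSpan ℝ ({x, y} : Set (EuclideanSpace ℝ (Fin n))) :
      Set (EuclideanSpace ℝ (Fin n))) / (dist x z * dist y z)
  else 0

/-- The point `(a, b) ∈ ℝ²` (with the Euclidean metric). -/
noncomputable def pt (a b : ℝ) : EuclideanSpace ℝ (Fin 2) :=
  (WithLp.equiv 2 (Fin 2 → ℝ)).symm ![a, b]

/-- The one-corner set `E_φ = ([0,1) × {0}) ∪ [0,1)·(cos φ, sin φ)`. -/
noncomputable def Eset (φ : ℝ) : Set (EuclideanSpace ℝ (Fin 2)) :=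
  {x | ∃ t ∈ Set.Ico (0:ℝ) 1, x = pt t 0} ∪
    {x | ∃ t ∈ Set.Ico (0:ℝ) 1, x = t • pt (Real.cos φ) (Real.sin φ)}

/-- Integral Menger curvature `M_p(X)` (innermost integration in `x`). -/
noncomputable def Mp (p : ℝ) (X : Set (EuclideanSpace ℝ (Fin 2))) : ℝ≥0∞ :=
  ∫⁻ z in X, ∫⁻ y in X, ∫⁻ x in X,
    (ENNReal.ofReal (menger x y z)) ^ p ∂μH[1] ∂μH[1] ∂μH[1]

/-- Intermediate energy `I_p(X)`. -/
noncomputable def Ip (p : ℝ) (X : Set (EuclideanSpace ℝ (Fin 2))) : ℝ≥0∞ :=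
  ∫⁻ y in X, ∫⁻ x in X,
    (⨆ z ∈ X, ENNReal.ofReal (menger x y z)) ^ p ∂μH[1] ∂μH[1]

/-- Global curvature energy `U_p(X)`. -/
noncomputable def Up (p : ℝ) (X : Set (EuclideanSpace ℝ (Fin 2))) : ℝ≥0∞ :=
  ∫⁻ x in X, (⨆ y ∈ X, ⨆ z ∈ X, ENNReal.ofReal (menger x y z)) ^ p ∂μH[1]

section PlaneGeometry

/-- Twice the signed area of the triangle with vertices `x`, `y`, `z`. -/
def doubleArea (x y z : EuclideanSpace ℝ (Fin 2)) : ℝ :=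
  (y 0 - x 0) * (z 1 - x 1) - (y 1 - x 1) * (z 0 - x 0)

lemma dist_sq_eq_coords (x y : EuclideanSpace ℝ (Fin 2)) :
    dist x y ^ 2 = (y 0 - x 0) ^ 2 + (y 1 - x 1) ^ 2 := by
  rw [EuclideanSpace.dist_eq, Real.sq_sqrt (by positivity), Fin.sum_univ_two]
  simp only [Real.dist_eq, sq_abs]
  ring

lemma mem_affineSpan_pair_iff_coords {x y w : EuclideanSpace ℝ (Fin 2)} :
    w ∈ affineSpan ℝ ({x, y} : Set (EuclideanSpace ℝ (Fin 2))) ↔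
      ∃ r : ℝ, w 0 = x 0 + r * (y 0 - x 0) ∧ w 1 = x 1 + r * (y 1 - x 1) := by
  rw [mem_affineSpan_pair_iff_exists_lineMap_eq]
  refine exists_congr fun r => ⟨?_, ?_⟩
  · rintro rfl
    simp [AffineMap.lineMap_apply]
    constructor <;> ring
  · rintro ⟨h0, h1⟩
    ext i
    fin_cases i
    · simp [AffineMap.lineMap_apply, h0]; ring
    · simp [AffineMap.lineMap_apply, h1]; ring

lemma infDist_affineSpan_pair_mul_dist {x y : EuclideanSpace ℝ (Fin 2)} (hxy : x ≠ y)
    (z : EuclideanSpace ℝ (Fin 2)) :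
    Metric.infDist z (affineSpan ℝ ({x, y} : Set (EuclideanSpace ℝ (Fin 2))) :
      Set (EuclideanSpace ℝ (Fin 2))) * dist x y = |doubleArea x y z| := by
  have hd : 0 < dist x y := dist_pos.2 hxy
  have hd2 := dist_sq_eq_coords x y
  have hne : (y 0 - x 0) ^ 2 + (y 1 - x 1) ^ 2 ≠ 0 := by rw [← hd2]; positivity
  apply le_antisymm
  · set r : ℝ := ((y 0 - x 0) * (z 0 - x 0) + (y 1 - x 1) * (z 1 - x 1)) /
      ((y 0 - x 0) ^ 2 + (y 1 - x 1) ^ 2) with hr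
    let w : EuclideanSpace ℝ (Fin 2) :=
      !₂[x 0 + r * (y 0 - x 0), x 1 + r * (y 1 - x 1)]
    have hw : w ∈ affineSpan ℝ ({x, y} : Set (EuclideanSpace ℝ (Fin 2))) :=
      mem_affineSpan_pair_iff_coords.2 ⟨r, by simp [w], by simp [w]⟩
    refine (mul_le_mul_of_nonneg_right (Metric.infDist_le_dist_of_mem hw) hd.le).trans ?_
    apply le_of_eq
    rw [← abs_of_nonneg (mul_nonneg dist_nonneg hd.le : 0 ≤ dist z w * dist x y),
      ← sq_eq_sq_iff_abs_eq_abs, mul_pow, hd2, dist_sq_eq_coords]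
    simp only [w, doubleArea]
    simp
    rw [hr]
    field_simp
    ring
  · rw [← div_le_iff₀ hd, Metric.le_infDist ⟨x, left_mem_affineSpan_pair ℝ x y⟩]
    intro w hw
    obtain ⟨r, h0, h1⟩ := mem_affineSpan_pair_iff_coords.1 hw
    rw [div_le_iff₀ hd]
    apply abs_le_of_sq_le_sq _ (by positivity)
    rw [mul_pow, hd2, dist_sq_eq_coords, h0, h1, doubleArea]
    nlinarith [sq_nonneg ((y 0 - x 0) * (x 0 + r * (y 0 - x 0) - z 0) +
      (y 1 - x 1) * (x 1 + r * (y 1 - x 1) - z 1))]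

lemma menger_nonneg {n : ℕ} (x y z : EuclideanSpace ℝ (Fin n)) : 0 ≤ menger x y z := by
  unfold menger
  split_ifs
  · exact div_nonneg (mul_nonneg two_pos.le Metric.infDist_nonneg) (by positivity)
  · exact le_rfl

lemma menger_mul_dist {x y z : EuclideanSpace ℝ (Fin 2)} (h : doubleArea x y z ≠ 0) :
    menger x y z * (dist x y * dist x z * dist y z) = 2 * |doubleArea x y z| := by
  have hxy : x ≠ y := by rintro rfl; simp [doubleArea] at h
  have hyz : y ≠ z := by rintro rfl; apply h; simp only [doubleArea]; ring
  have hxz : x ≠ z := by rintro rfl; simp [doubleArea] at h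
  have hc : ¬ Collinear ℝ ({x, y, z} : Set (EuclideanSpace ℝ (Fin 2))) := by
    intro hc
    obtain ⟨r, h0, h1⟩ := mem_affineSpan_pair_iff_coords.1
      (hc.mem_affineSpan_of_mem_of_ne (p₁ := x) (p₂ := y) (p₃ := z)
        (by simp) (by simp) (by simp) hxy)
    apply h
    rw [doubleArea, h0, h1]
    ring
  have := dist_pos.2 hxz
  have := dist_pos.2 hyz
  rw [menger, if_pos ⟨hxy, hyz, hxz, hc⟩, ← infDist_affineSpan_pair_mul_dist hxy]
  field_simp

lemma menger_eq_zero {x y z : EuclideanSpace ℝ (Fin 2)} (h : doubleArea x y z = 0) :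
    menger x y z = 0 := by
  unfold menger
  split_ifs with hc
  · have := infDist_affineSpan_pair_mul_dist hc.1 z
    rw [h, abs_zero, mul_eq_zero, or_iff_left (dist_pos.2 hc.1).ne'] at this
    simp [this]
  · rfl

end PlaneGeometry

section Axes

@[simp] lemma pt_apply_zero (a b : ℝ) : pt a b 0 = a := rfl

@[simp] lemma pt_apply_one (a b : ℝ) : pt a b 1 = b := rfl

lemma dist_pt (a b c d : ℝ) : dist (pt a b) (pt c d) = √((c - a) ^ 2 + (d - b) ^ 2) := by
  rw [← Real.sqrt_sq (dist_nonneg (x := pt a b)), dist_sq_eq_coords]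
  simp

lemma norm_pt (a b : ℝ) : ‖pt a b‖ = √(a ^ 2 + b ^ 2) := by
  rw [EuclideanSpace.norm_eq, Fin.sum_univ_two]
  simp

lemma isometry_pt_left : Isometry fun t : ℝ => pt t 0 :=
  Isometry.of_dist_eq fun s t => by simp [dist_pt, Real.sqrt_sq_eq_abs, Real.dist_eq, abs_sub_comm]

lemma isometry_pt_right : Isometry fun t : ℝ => pt 0 t :=
  Isometry.of_dist_eq fun s t => by simp [dist_pt, Real.sqrt_sq_eq_abs, Real.dist_eq, abs_sub_comm]

lemma Eset_pi_div_two :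
    Eset (π / 2) = (fun t : ℝ => pt t 0) '' Set.Ico 0 1 ∪ (fun t : ℝ => pt 0 t) '' Set.Ico 0 1 := by
  have h (t : ℝ) : t • pt (Real.cos (π / 2)) (Real.sin (π / 2)) = pt 0 t := by
    ext i
    fin_cases i <;> simp [pt]
  simp only [Eset, h]
  congr 1 <;> ext x <;> simp only [Set.mem_ofPred_eq, Set.mem_image, eq_comm]

lemma setLIntegral_image_hausdorffMeasure_one {f : ℝ → EuclideanSpace ℝ (Fin 2)}
    (hf : Isometry f) (s : Set ℝ) (g : EuclideanSpace ℝ (Fin 2) → ℝ≥0∞) :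
    ∫⁻ x in f '' s, g x ∂μH[1] = ∫⁻ t in s, g (f t) := by
  have he : MeasurableEmbedding f := hf.isClosedEmbedding.measurableEmbedding
  have hs : f '' s ⊆ Set.range f := Set.image_subset_range f s
  rw [← Measure.restrict_restrict_of_subset hs, ← hf.map_hausdorffMeasure (Or.inl zero_le_one),
    hausdorffMeasure_real, he.restrict_map, he.lintegral_map, Set.preimage_image_eq _ hf.injective]

lemma pow_three_mul_le_of_mul_eq {m d a b c r s : ℝ} (hd : d ≠ 0) (hb : 0 ≤ b)
    (hc : 0 ≤ c) (hr : 0 < r) (hs : 0 < s) (har : a ≤ r) (hcr : c ≤ r) (hbs : b ≤ s) (hcs : c ≤ s)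
    (h : m * (d * r * s) = 2 * (d * c)) : m ^ 3 * (a * b * c) ≤ 8 := by
  have h1 : m * (r * s) = 2 * c := mul_left_cancel₀ hd (by linarith)
  have h2 : a * c ^ 2 ≤ r ^ 3 := by
    calc a * c ^ 2 ≤ r * r ^ 2 := by gcongr
      _ = r ^ 3 := by ring
  have h3 : b * c ^ 2 ≤ s ^ 3 := by
    calc b * c ^ 2 ≤ s * s ^ 2 := by gcongr
      _ = s ^ 3 := by ring
  refine le_of_mul_le_mul_right ?_ (by positivity : 0 < (r * s) ^ 3)
  calc m ^ 3 * (a * b * c) * (r * s) ^ 3 = (m * (r * s)) ^ 3 * (a * b * c) := by ring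
    _ = 8 * ((a * c ^ 2) * (b * c ^ 2)) := by rw [h1]; ring
    _ ≤ 8 * (r ^ 3 * s ^ 3) := by gcongr
    _ = 8 * (r * s) ^ 3 := by ring

lemma menger_pow_three_mul_norm_le {x y z : EuclideanSpace ℝ (Fin 2)}
    (hx : x ∈ Eset (π / 2)) (hy : y ∈ Eset (π / 2)) (hz : z ∈ Eset (π / 2)) :
    menger x y z ^ 3 * (‖x‖ * ‖y‖ * ‖z‖) ≤ 8 := by
  by_cases h : doubleArea x y z = 0
  · simp [menger_eq_zero h]
  have hm := menger_mul_dist h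
  have le_left (a c : ℝ) : a ≤ √(a ^ 2 + c ^ 2) := Real.le_sqrt_of_sq_le (by nlinarith)
  have le_right (a c : ℝ) : c ≤ √(a ^ 2 + c ^ 2) := Real.le_sqrt_of_sq_le (by nlinarith)
  have sqrt_pos {a c : ℝ} (ha : a ≠ 0) : 0 < √(a ^ 2 + c ^ 2) := by positivity
  have sqrt_pos' {a c : ℝ} (hc : c ≠ 0) : 0 < √(a ^ 2 + c ^ 2) := by positivity
  rw [Eset_pi_div_two] at hx hy hz
  rcases hx with ⟨a, ⟨ha, -⟩, rfl⟩ | ⟨a, ⟨ha, -⟩, rfl⟩ <;>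
  rcases hy with ⟨b, ⟨hb, -⟩, rfl⟩ | ⟨b, ⟨hb, -⟩, rfl⟩ <;>
  rcases hz with ⟨c, ⟨hc, -⟩, rfl⟩ | ⟨c, ⟨hc, -⟩, rfl⟩ <;>
  simp [doubleArea, dist_pt, norm_pt, Real.sqrt_sq_eq_abs, abs_mul, abs_of_nonneg, ha, hb, hc] at h hm ⊢
  · exact pow_three_mul_le_of_mul_eq (abs_ne_zero.2 h.1) hb hc (sqrt_pos' h.2)
      (sqrt_pos' h.2) (le_left _ _) (le_right _ _) (le_left _ _) (le_right _ _) hm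
  · rw [mul_right_comm]
    exact pow_three_mul_le_of_mul_eq (abs_ne_zero.2 h.2) hc hb (sqrt_pos' h.1)
      (sqrt_pos' h.1) (le_left _ _) (le_right _ _) (le_left _ _) (le_right _ _)
      (by linear_combination hm)
  · have e : -(a * c) + b * a = a * (b - c) := by ring
    rw [e] at h hm
    have ha' := left_ne_zero_of_mul h
    rw [abs_mul, abs_of_nonneg ha, abs_sub_comm] at hm
    rw [mul_rotate]
    exact pow_three_mul_le_of_mul_eq (abs_ne_zero.2 (right_ne_zero_of_mul h)) hc ha
      (sqrt_pos ha') (sqrt_pos ha') (le_right _ _) (le_left _ _) (le_right _ _) (le_left _ _)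
      (by linear_combination hm)
  · have e : -(b * a) + a * c = a * (c - b) := by ring
    rw [e] at h hm
    have ha' := left_ne_zero_of_mul h
    rw [abs_mul, abs_of_nonneg ha] at hm
    rw [mul_rotate]
    exact pow_three_mul_le_of_mul_eq (abs_ne_zero.2 (right_ne_zero_of_mul h)) hc ha
      (sqrt_pos' ha') (sqrt_pos' ha') (le_left _ _) (le_right _ _) (le_left _ _) (le_right _ _)
      (by linear_combination hm)
  · rw [mul_right_comm]
    exact pow_three_mul_le_of_mul_eq (abs_ne_zero.2 h.2) hc hb (sqrt_pos h.1)
      (sqrt_pos h.1) (le_right _ _) (le_left _ _) (le_right _ _) (le_left _ _)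
      (by linear_combination hm)
  · exact pow_three_mul_le_of_mul_eq (abs_ne_zero.2 h.1) hb hc (sqrt_pos h.2)
      (sqrt_pos h.2) (le_right _ _) (le_left _ _) (le_right _ _) (le_left _ _) hm

lemma ofReal_menger_rpow_le {p : ℝ} (hp : 0 < p) {x y z : EuclideanSpace ℝ (Fin 2)}
    (hx : x ∈ Eset (π / 2)) (hy : y ∈ Eset (π / 2)) (hz : z ∈ Eset (π / 2)) :
    ENNReal.ofReal (menger x y z) ^ p ≤
      8 ^ (p / 3) * ‖z‖ₑ ^ (-(p / 3)) * ‖y‖ₑ ^ (-(p / 3)) * ‖x‖ₑ ^ (-(p / 3)) := by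
  have hq : 0 ≤ p / 3 := by positivity
  have h : ENNReal.ofReal (menger x y z) ^ 3 * (‖x‖ₑ * ‖y‖ₑ * ‖z‖ₑ) ≤ 8 := by
    have := ENNReal.ofReal_le_ofReal (menger_pow_three_mul_norm_le hx hy hz)
    rwa [ENNReal.ofReal_mul (pow_nonneg (menger_nonneg x y z) 3),
      ENNReal.ofReal_pow (menger_nonneg x y z), ENNReal.ofReal_mul (by positivity),
      ENNReal.ofReal_mul (norm_nonneg x), ofReal_norm, ofReal_norm, ofReal_norm,
      ENNReal.ofReal_ofNat] at this
  rw [← ENNReal.le_div_iff_mul_le (Or.inr (by norm_num)) (Or.inr (by norm_num))] at h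
  calc ENNReal.ofReal (menger x y z) ^ p
      = (ENNReal.ofReal (menger x y z) ^ 3) ^ (p / 3) := by
        rw [← ENNReal.rpow_natCast, ← ENNReal.rpow_mul]
        congr 1
        push_cast
        ring
    _ ≤ (8 / (‖x‖ₑ * ‖y‖ₑ * ‖z‖ₑ)) ^ (p / 3) := ENNReal.rpow_le_rpow h hq
    _ = _ := by
        rw [ENNReal.div_rpow_of_nonneg _ _ hq, div_eq_mul_inv,
          ENNReal.mul_rpow_of_ne_top (by finiteness) (by finiteness),
          ENNReal.mul_rpow_of_ne_top (by finiteness) (by finiteness),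
          ENNReal.mul_inv (Or.inr (by finiteness)) (Or.inl (by finiteness)),
          ENNReal.mul_inv (Or.inr (by finiteness)) (Or.inl (by finiteness))]
        simp only [ENNReal.rpow_neg]
        ring

lemma setLIntegral_Ioo_ofReal_rpow_lt_top_iff {s : ℝ} :
    ∫⁻ t in Set.Ioo (0 : ℝ) 1, ENNReal.ofReal t ^ s < ⊤ ↔ -1 < s := by
  rw [← intervalIntegral.integrableOn_Ioo_rpow_iff zero_lt_one, IntegrableOn,
    ← lintegral_ofReal_ne_top_iff_integrable, lt_top_iff_ne_top]
  · refine not_congr (Eq.congr_left ?_)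
    exact setLIntegral_congr_fun measurableSet_Ioo
      fun t ht => ENNReal.ofReal_rpow_of_pos ht.1
  · exact (measurable_id.pow_const s).aestronglyMeasurable
  · exact (ae_restrict_mem measurableSet_Ioo).mono fun t ht => Real.rpow_nonneg ht.1.le s

lemma setLIntegral_Eset_enorm_rpow_lt_top {s : ℝ} (hs : -1 < s) :
    ∫⁻ x in Eset (π / 2), ‖x‖ₑ ^ s ∂μH[1] < ⊤ := by
  rw [Eset_pi_div_two]
  refine (lintegral_union_le _ _ _).trans_lt ?_
  rw [setLIntegral_image_hausdorffMeasure_one isometry_pt_left,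
    setLIntegral_image_hausdorffMeasure_one isometry_pt_right,
    setLIntegral_congr Ioo_ae_eq_Ico.symm, setLIntegral_congr Ioo_ae_eq_Ico.symm]
  have key := setLIntegral_Ioo_ofReal_rpow_lt_top_iff.2 hs
  refine ENNReal.add_lt_top.2 ⟨?_, ?_⟩ <;>
  · refine lt_of_eq_of_lt (setLIntegral_congr_fun measurableSet_Ioo fun t ht => ?_) key
    simp [← ofReal_norm, norm_pt, Real.sqrt_sq ht.1.le]

lemma Mp_Eset_pi_div_two_lt_top {p : ℝ} (hp : 0 < p) (hp3 : p < 3) :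
    Mp p (Eset (π / 2)) < ⊤ := by
  have hI := setLIntegral_Eset_enorm_rpow_lt_top (s := -(p / 3)) (by linarith)
  set I := ∫⁻ x in Eset (π / 2), ‖x‖ₑ ^ (-(p / 3)) ∂μH[1] with hIdef
  have hmeas : Measurable fun x : EuclideanSpace ℝ (Fin 2) => ‖x‖ₑ ^ (-(p / 3)) :=
    measurable_enorm.pow_const _
  have hE : MeasurableSet (Eset (π / 2)) := by
    rw [Eset_pi_div_two]
    exact (isometry_pt_left.isClosedEmbedding.measurableEmbedding.measurableSet_image.2
      measurableSet_Ico).union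
      (isometry_pt_right.isClosedEmbedding.measurableEmbedding.measurableSet_image.2
      measurableSet_Ico)
  calc Mp p (Eset (π / 2))
      ≤ ∫⁻ z in Eset (π / 2), ∫⁻ y in Eset (π / 2), ∫⁻ x in Eset (π / 2),
          8 ^ (p / 3) * ‖z‖ₑ ^ (-(p / 3)) * ‖y‖ₑ ^ (-(p / 3)) * ‖x‖ₑ ^ (-(p / 3))
          ∂μH[1] ∂μH[1] ∂μH[1] :=
        setLIntegral_mono' hE fun z hz => setLIntegral_mono' hE fun y hy =>
          setLIntegral_mono' hE fun x hx => ofReal_menger_rpow_le hp hx hy hz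
    _ = 8 ^ (p / 3) * I * I * I := by
        simp_rw [lintegral_const_mul _ hmeas, ← hIdef, lintegral_mul_const _ (hmeas.const_mul _),
          lintegral_const_mul _ hmeas, ← hIdef]
        rw [lintegral_mul_const _ ((hmeas.const_mul _).mul_const _),
          lintegral_mul_const _ (hmeas.const_mul _), lintegral_const_mul _ hmeas]
    _ < ⊤ := by finiteness

lemma le_menger_of_mem_Ioo {a b c : ℝ} (hc : 0 < c) (ha : a ∈ Set.Ioo 0 (c / 2))
    (hb : b ∈ Set.Ioo (c / 2) c) : c⁻¹ ≤ menger (pt a 0) (pt b 0) (pt 0 c) := by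
  obtain ⟨ha0, ha⟩ := ha
  obtain ⟨hb0, hb⟩ := hb
  have hab : 0 < b - a := by linarith
  have hD : doubleArea (pt a 0) (pt b 0) (pt 0 c) = (b - a) * c := by simp [doubleArea]
  have hm := menger_mul_dist (hD ▸ (by positivity : (b - a) * c ≠ 0))
  rw [hD, abs_of_pos (by positivity)] at hm
  simp only [dist_pt, sub_zero, zero_sub, sub_self, neg_sq, zero_pow two_ne_zero, add_zero,
    Real.sqrt_sq hab.le] at hm
  have h1 : menger (pt a 0) (pt b 0) (pt 0 c) * (√(a ^ 2 + c ^ 2) * √(b ^ 2 + c ^ 2)) = 2 * c :=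
    mul_left_cancel₀ hab.ne' (by linear_combination hm)
  have h2 : √(a ^ 2 + c ^ 2) * √(b ^ 2 + c ^ 2) ≤ 2 * c ^ 2 := by
    rw [← Real.sqrt_mul (by positivity)]
    apply Real.sqrt_le_iff.2 ⟨by positivity, ?_⟩
    have h3 : a ^ 2 + c ^ 2 ≤ 2 * c ^ 2 := by nlinarith
    have h4 : b ^ 2 + c ^ 2 ≤ 2 * c ^ 2 := by nlinarith
    calc (a ^ 2 + c ^ 2) * (b ^ 2 + c ^ 2) ≤ (2 * c ^ 2) * (2 * c ^ 2) := by gcongr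
      _ = (2 * c ^ 2) ^ 2 := by ring
  rw [inv_le_iff_one_le_mul₀ hc]
  have h5 := mul_le_mul_of_nonneg_left h2 (menger_nonneg (pt a 0) (pt b 0) (pt 0 c))
  rw [h1] at h5
  nlinarith

lemma Mp_Eset_pi_div_two_eq_top {p : ℝ} (hp3 : 3 ≤ p) : Mp p (Eset (π / 2)) = ⊤ := by
  have hp : 0 < p := by linarith
  have hA : (fun t : ℝ => pt t 0) '' Set.Ico 0 1 ⊆ Eset (π / 2) :=
    Eset_pi_div_two ▸ Set.subset_union_left
  have hB : (fun t : ℝ => pt 0 t) '' Set.Ico 0 1 ⊆ Eset (π / 2) :=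
    Eset_pi_div_two ▸ Set.subset_union_right
  have hdiv : ∫⁻ t in Set.Ioo (0 : ℝ) 1, ENNReal.ofReal t ^ (2 - p) = ⊤ := by
    by_contra h
    have := setLIntegral_Ioo_ofReal_rpow_lt_top_iff.1 (lt_top_iff_ne_top.2 h)
    linarith
  have hinner {c : ℝ} (hc : c ∈ Set.Ioo (0 : ℝ) 1) :
      ENNReal.ofReal 4⁻¹ * ENNReal.ofReal c ^ (2 - p) ≤
      ∫⁻ y in Eset (π / 2), ∫⁻ x in Eset (π / 2),
        ENNReal.ofReal (menger x y (pt 0 c)) ^ p ∂μH[1] ∂μH[1] := by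
    obtain ⟨hc0, hc1⟩ := hc
    have hI1 : Set.Ioo 0 (c / 2) ⊆ Set.Ico (0 : ℝ) 1 :=
      fun t ht => ⟨ht.1.le, by linarith [ht.2]⟩
    have hI2 : Set.Ioo (c / 2) c ⊆ Set.Ico (0 : ℝ) 1 :=
      fun t ht => ⟨by linarith [ht.1], by linarith [ht.2]⟩
    calc ENNReal.ofReal 4⁻¹ * ENNReal.ofReal c ^ (2 - p)
        = ∫⁻ _ in Set.Ioo (c / 2) c, ∫⁻ _ in Set.Ioo 0 (c / 2), ENNReal.ofReal c⁻¹ ^ p := by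
          simp only [setLIntegral_const, Real.volume_Ioo, sub_zero, sub_half]
          rw [ENNReal.ofReal_rpow_of_pos hc0, ENNReal.ofReal_rpow_of_pos (by positivity),
            ← ENNReal.ofReal_mul (by positivity), ← ENNReal.ofReal_mul (by positivity),
            ← ENNReal.ofReal_mul (by positivity), Real.inv_rpow hc0.le, Real.rpow_sub hc0,
            Real.rpow_two]
          congr 1
          ring
      _ ≤ ∫⁻ b in Set.Ioo (c / 2) c, ∫⁻ a in Set.Ioo 0 (c / 2),
            ENNReal.ofReal (menger (pt a 0) (pt b 0) (pt 0 c)) ^ p :=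
          setLIntegral_mono' measurableSet_Ioo fun b hb =>
            setLIntegral_mono' measurableSet_Ioo fun a ha =>
              ENNReal.rpow_le_rpow (ENNReal.ofReal_le_ofReal (le_menger_of_mem_Ioo hc0 ha hb)) hp.le
      _ ≤ ∫⁻ b in Set.Ico (0 : ℝ) 1, ∫⁻ a in Set.Ico (0 : ℝ) 1,
            ENNReal.ofReal (menger (pt a 0) (pt b 0) (pt 0 c)) ^ p :=
          (lintegral_mono fun _ => lintegral_mono_set hI1).trans (lintegral_mono_set hI2)
      _ = ∫⁻ y in (fun t : ℝ => pt t 0) '' Set.Ico 0 1,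
            ∫⁻ x in (fun t : ℝ => pt t 0) '' Set.Ico 0 1,
            ENNReal.ofReal (menger x y (pt 0 c)) ^ p ∂μH[1] ∂μH[1] := by
          simp_rw [setLIntegral_image_hausdorffMeasure_one isometry_pt_left]
      _ ≤ _ := (lintegral_mono fun _ => lintegral_mono_set hA).trans (lintegral_mono_set hA)
  rw [eq_top_iff]
  calc ⊤ = ENNReal.ofReal 4⁻¹ * ∫⁻ t in Set.Ioo (0 : ℝ) 1, ENNReal.ofReal t ^ (2 - p) := by
        rw [hdiv, ENNReal.mul_top (by simp)]
    _ = ∫⁻ t in Set.Ioo (0 : ℝ) 1, ENNReal.ofReal 4⁻¹ * ENNReal.ofReal t ^ (2 - p) :=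
        (lintegral_const_mul' _ _ ENNReal.ofReal_ne_top).symm
    _ ≤ ∫⁻ c in Set.Ioo (0 : ℝ) 1, ∫⁻ y in Eset (π / 2), ∫⁻ x in Eset (π / 2),
          ENNReal.ofReal (menger x y (pt 0 c)) ^ p ∂μH[1] ∂μH[1] :=
        setLIntegral_mono' measurableSet_Ioo fun c hc => hinner hc
    _ ≤ ∫⁻ c in Set.Ico (0 : ℝ) 1, ∫⁻ y in Eset (π / 2), ∫⁻ x in Eset (π / 2),
          ENNReal.ofReal (menger x y (pt 0 c)) ^ p ∂μH[1] ∂μH[1] :=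
        lintegral_mono_set Set.Ioo_subset_Ico_self
    _ = ∫⁻ z in (fun t : ℝ => pt 0 t) '' Set.Ico 0 1, ∫⁻ y in Eset (π / 2),
          ∫⁻ x in Eset (π / 2), ENNReal.ofReal (menger x y z) ^ p ∂μH[1] ∂μH[1] ∂μH[1] :=
        (setLIntegral_image_hausdorffMeasure_one isometry_pt_right _
          fun z => ∫⁻ y in Eset (π / 2), ∫⁻ x in Eset (π / 2),
            ENNReal.ofReal (menger x y z) ^ p ∂μH[1] ∂μH[1]).symm
    _ ≤ Mp p (Eset (π / 2)) := lintegral_mono_set hB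

end Axes

/-- `M_p(E_{π/2}) < ∞` if and only if `p ∈ (0,3)`. -/
theorem Mp_Eset_pi_div_two_lt_top_iff (p : ℝ) (hp : 0 < p) :
    Mp p (Eset (π / 2)) < ⊤ ↔ p ∈ Set.Ioo (0:ℝ) 3 := by
  refine ⟨fun h => ⟨hp, ?_⟩, fun h => Mp_Eset_pi_div_two_lt_top h.1 h.2⟩
  by_contra! h3
  exact h.ne (Mp_Eset_pi_div_two_eq_top h3)
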